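/- arXiv:1805.05224 — 2 statements merged into one kernel-verified Lean document; each statement's English description precedes it below -/
import Mathlib

section
/- For all positive integers n and k, the expectation of gap(f)^{2k} over a uniformly random f ∈ 𝓕ₙ equals the number of 2k × n matrices X over 𝔽₂ such that for every (not necessarily distinct) triple of column indices a, b, c ∈ {1,…,n}, ∑_{j=1}^{2k} X_{j,a} X_{j,b} X_{j,c} = 0 in 𝔽₂. That is, E_{f ∈ 𝓕ₙ}[gap(f)^{2k}] = #{ X ∈ 𝔽₂^{2k×n} : ⟨X_a, X_b, X_c⟩ = 0 for all columns a,b,c }. -/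
/-- The gap of a Boolean function on a finite domain:
`gap f = ∑_x (−1)^{f(x)}`, i.e. `+1` for each `x` with `f x = 0` and `−1` otherwise. -/
def gap {σ : Type*} [Fintype σ] (f : σ → ZMod 2) : ℤ :=
  ∑ x : σ, if f x = 0 then 1 else -1

/-- Index set of monomials of a degree-≤3 polynomial over 𝔽₂ in `n` variables with no
constant term: nonempty subsets of the variables of size at most 3. -/
abbrev MonIdx (n : ℕ) := {S : Finset (Fin n) // S.Nonempty ∧ S.card ≤ 3}

/-- A coefficient assignment, i.e. an element of 𝓕ₙ: a polynomial over 𝔽₂ in `n` variables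
of total degree ≤ 3 with zero constant term, recorded by its (multilinear) coefficients. -/
abbrev Coeffs (n : ℕ) := MonIdx n → ZMod 2

/-- The Boolean function `𝔽₂ⁿ → 𝔽₂` evaluated by the polynomial with coefficients `α`. -/
def polyFun {n : ℕ} (α : Coeffs n) : (Fin n → ZMod 2) → ZMod 2 :=
  fun z => ∑ S : MonIdx n, α S * ∏ i ∈ S.1, z i

/-- The nontrivial character of `𝔽₂`, sending `0` to `1` and `1` to `-1`. -/
def signChar : AddChar (ZMod 2) ℚ where
  toFun x := if x = 0 then 1 else -1
  map_zero_eq_one' := by simp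
  map_add_eq_mul' x y := by fin_cases x <;> fin_cases y <;> simp <;> decide

lemma signChar_apply (x : ZMod 2) : signChar x = if x = 0 then 1 else -1 := rfl

lemma signChar_eq_one_iff (x : ZMod 2) : signChar x = 1 ↔ x = 0 := by
  rw [signChar_apply]
  split_ifs with h <;> norm_num [h]

lemma signChar_sum {ι : Type*} (s : Finset ι) (g : ι → ZMod 2) :
    signChar (∑ i ∈ s, g i) = ∏ i ∈ s, signChar (g i) :=
  map_prod signChar.toMonoidHom (fun i => Multiplicative.ofAdd (g i)) s

/-- Every power of the gap is a character sum over tuples of points. -/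
lemma gap_pow {σ : Type*} [Fintype σ] (f : σ → ZMod 2) (m : ℕ) :
    (gap f : ℚ) ^ m = ∑ X : Fin m → σ, signChar (∑ j, f (X j)) := by
  have h : (gap f : ℚ) = ∑ x, signChar (f x) := by
    simp [gap, signChar_apply]
  rw [h, Fintype.sum_pow]
  exact Finset.sum_congr rfl fun X _ => (signChar_sum _ _).symm

/-- Orthogonality of characters on `ι → 𝔽₂`. -/
lemma sum_signChar_dotProduct {ι : Type*} [Fintype ι] [DecidableEq ι] (v : ι → ZMod 2)
    [Decidable (v = 0)] :
    ∑ α : ι → ZMod 2, signChar (∑ i, α i * v i) =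
      if v = 0 then (Fintype.card (ι → ZMod 2) : ℚ) else 0 := by
  split_ifs with hv
  · simp [hv]
  · let φ : (ι → ZMod 2) →+ ZMod 2 :=
      { toFun := fun α => ∑ i, α i * v i
        map_zero' := by simp
        map_add' := fun α β => by simp [add_mul, Finset.sum_add_distrib] }
    refine AddChar.sum_eq_zero_of_ne_one (ψ := signChar.compAddMonoidHom φ) fun h => hv ?_
    ext i
    have hi := DFunLike.congr_fun h (Pi.single i 1)
    rw [AddChar.compAddMonoidHom_apply, AddChar.one_apply, signChar_eq_one_iff] at hi
    simpa [φ, Pi.single_apply] using hi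

lemma mul_self_zmod_two (x : ZMod 2) : x * x = x := by decide +revert

lemma prod_triple_zmod_two {ι : Type*} [DecidableEq ι] (z : ι → ZMod 2) (a b c : ι) :
    ∏ i ∈ ({a, b, c} : Finset ι), z i = z a * z b * z c := by
  have insert_mul (s : Finset ι) (x : ι) : ∏ i ∈ insert x s, z i = z x * ∏ i ∈ s, z i := by
    by_cases hx : x ∈ s
    · rw [Finset.insert_eq_of_mem hx, ← Finset.mul_prod_erase s z hx, ← mul_assoc,
        mul_self_zmod_two]
    · exact Finset.prod_insert hx
  rw [insert_mul, insert_mul, Finset.prod_singleton, mul_assoc]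

lemma Finset.exists_eq_triple {ι : Type*} [DecidableEq ι] {S : Finset ι} (hS : S.Nonempty)
    (hcard : S.card ≤ 3) : ∃ a b c, S = {a, b, c} := by
  have hpos := hS.card_pos
  obtain h | h | h : S.card = 1 ∨ S.card = 2 ∨ S.card = 3 := by omega
  · obtain ⟨a, rfl⟩ := Finset.card_eq_one.1 h
    exact ⟨a, a, a, by simp⟩
  · obtain ⟨a, b, -, rfl⟩ := Finset.card_eq_two.1 h
    exact ⟨a, b, b, by simp⟩
  · obtain ⟨a, b, c, -, -, -, rfl⟩ := Finset.card_eq_three.1 h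
    exact ⟨a, b, c, rfl⟩

lemma monomial_sums_eq_zero_iff {n m : ℕ} (X : Fin m → Fin n → ZMod 2) :
    (fun S : MonIdx n => ∑ j, ∏ i ∈ S.1, X j i) = 0 ↔
      ∀ a b c : Fin n, ∑ j, X j a * X j b * X j c = 0 := by
  constructor
  · intro h a b c
    have := congr_fun h ⟨{a, b, c}, by simp, Finset.card_le_three⟩
    simpa only [prod_triple_zmod_two, Pi.zero_apply] using this
  · intro h
    ext ⟨S, hS, hcard⟩
    obtain ⟨a, b, c, rfl⟩ := Finset.exists_eq_triple hS hcard
    simpa only [prod_triple_zmod_two, Pi.zero_apply] using h a b c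

lemma sum_polyFun {n m : ℕ} (α : Coeffs n) (X : Fin m → Fin n → ZMod 2) :
    ∑ j, polyFun α (X j) = ∑ S : MonIdx n, α S * ∑ j, ∏ i ∈ S.1, X j i := by
  simp only [polyFun, Finset.mul_sum]
  exact Finset.sum_comm

/-- `E_{f ∈ 𝓕ₙ}[gap(f)^{2k}]` equals the number of `2k × n` matrices `X` over
𝔽₂ all of whose triples of columns `a,b,c` satisfy `∑_j X_{j,a} X_{j,b} X_{j,c} = 0`. -/
theorem stmt2 (n k : ℕ) (hn : 1 ≤ n) (hk : 1 ≤ k) :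
    (∑ α : Coeffs n, ((gap (polyFun α) : ℚ)) ^ (2 * k)) / (Fintype.card (Coeffs n)) =
      Fintype.card {X : Fin (2 * k) → Fin n → ZMod 2 //
        ∀ a b c : Fin n, ∑ j : Fin (2 * k), X j a * X j b * X j c = 0} := by
  have hcard : (Fintype.card (Coeffs n) : ℚ) ≠ 0 := Nat.cast_ne_zero.2 Fintype.card_ne_zero
  rw [div_eq_iff hcard]
  simp only [gap_pow, sum_polyFun]
  rw [Finset.sum_comm]
  simp only [sum_signChar_dotProduct, monomial_sums_eq_zero_iff]
  rw [← Finset.sum_filter, Finset.sum_const, nsmul_eq_mul, Fintype.card_subtype]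
end

section
/- There exists n₀ such that for all n > n₀: both the fraction of f ∈ 𝓕ₙ^prom with gap(f)² ≥ 2^{n−1} (YES instances) and the fraction of f ∈ 𝓕ₙ^prom with gap(f)² ≤ 2^{n−2} (NO instances) are at most 11/12. Consequently, an algorithm that always outputs the same answer solves the promise problem on at most an 11/12 fraction of instances of 𝓕ₙ^prom for large n. -/
open Finset Filter Topology

/-- The sign character `a ↦ (−1)^a` of `𝔽₂`, with real values. -/
def sgn (a : ZMod 2) : ℝ := if a = 0 then 1 else -1

theorem sgn_zero : sgn 0 = 1 := by simp [sgn]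

theorem sgn_one : sgn 1 = -1 := by simp [sgn]

theorem sgn_add (a b : ZMod 2) : sgn (a + b) = sgn a * sgn b := by
  have h : (1 : ZMod 2) + 1 = 0 := by decide
  have ht : ∀ c : ZMod 2, c = 0 ∨ c = 1 := by decide
  rcases ht a with rfl | rfl <;> rcases ht b with rfl | rfl <;> simp [sgn, h]

theorem sgn_sum {ι : Type*} (s : Finset ι) (f : ι → ZMod 2) :
    sgn (∑ i ∈ s, f i) = ∏ i ∈ s, sgn (f i) := by
  classical
  induction s using Finset.induction_on with
  | empty => simp [sgn_zero]
  | insert a s ha ih => rw [sum_insert ha, prod_insert ha, sgn_add, ih]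

/-- Orthogonality: a nontrivial linear form on `𝔽₂^ι` is balanced. -/
theorem sum_sgn_linear {ι : Type*} [Fintype ι] [DecidableEq ι] (c : ι → ZMod 2) :
    ∑ a : ι → ZMod 2, sgn (∑ i, a i * c i) =
      if ∀ i, c i = 0 then (2 : ℝ) ^ Fintype.card ι else 0 := by
  have h1 : ∀ x : ZMod 2, ∑ a : ZMod 2, sgn (a * x) = if x = 0 then 2 else 0 := by
    intro x
    have : (univ : Finset (ZMod 2)) = {0, 1} := by decide
    rw [this]
    have ht : ∀ c : ZMod 2, c = 0 ∨ c = 1 := by decide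
    rcases ht x with rfl | rfl <;> norm_num [sgn]
  simp_rw [sgn_sum]
  have := (Fintype.prod_sum (fun i (a : ZMod 2) => sgn (a * c i))).symm
  rw [this]
  simp_rw [h1]
  split_ifs with h
  · simp [h]
  · push Not at h
    obtain ⟨i, hi⟩ := h
    exact prod_eq_zero (mem_univ i) (by simp [hi])

/-- The `m`-th power moment of a sum of signs counts the tuples whose induced linear form on the
coefficients vanishes. -/
theorem sum_pow_eq_card {ι V : Type*} [Fintype ι] [DecidableEq ι] [Fintype V] (e : ι → V → ZMod 2)
    (m : ℕ) :
    ∑ a : ι → ZMod 2, (∑ x, sgn (∑ i, a i * e i x)) ^ m =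
      (2 : ℝ) ^ Fintype.card ι *
        (univ.filter fun p : Fin m → V => ∀ i, ∑ j, e i (p j) = 0).card := by
  classical
  have h : ∀ a : ι → ZMod 2, (∑ x, sgn (∑ i, a i * e i x)) ^ m =
      ∑ p : Fin m → V, sgn (∑ i, a i * ∑ j, e i (p j)) := by
    intro a
    rw [Fintype.sum_pow]
    refine sum_congr rfl fun p _ => ?_
    rw [← sgn_sum, sum_comm]
    simp_rw [mul_sum]
  simp_rw [h]
  rw [sum_comm]
  simp_rw [sum_sgn_linear]
  rw [sum_ite]
  simp [mul_comm]

/-- The sum of `φ` over the endpoints of all `2 ^ N` walks with `N` steps `±1`. -/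
def walkSum (N : ℕ) (φ : ℝ → ℝ) : ℝ := ∑ g : Fin N → ZMod 2, φ (∑ i, sgn (g i))

theorem walkSum_zero (φ : ℝ → ℝ) : walkSum 0 φ = φ 0 := by simp [walkSum]

theorem walkSum_succ (N : ℕ) (φ : ℝ → ℝ) :
    walkSum (N + 1) φ = walkSum N (fun x => φ (x + 1)) + walkSum N (fun x => φ (x - 1)) := by
  unfold walkSum
  rw [← (Fin.consEquiv fun _ => ZMod 2).sum_comp, Fintype.sum_prod_type]
  have : (univ : Finset (ZMod 2)) = {0, 1} := by decide
  rw [this, sum_pair (by decide)]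
  simp [Fin.sum_univ_succ, Fin.consEquiv, sgn_zero, sgn_one, add_comm, sub_eq_add_neg]

theorem walkSum_add (N : ℕ) (φ ψ : ℝ → ℝ) :
    walkSum N (fun x => φ x + ψ x) = walkSum N φ + walkSum N ψ := by
  simp [walkSum, sum_add_distrib]

theorem walkSum_sub (N : ℕ) (φ ψ : ℝ → ℝ) :
    walkSum N (fun x => φ x - ψ x) = walkSum N φ - walkSum N ψ := by
  simp [walkSum, sum_sub_distrib]

theorem walkSum_mul (N : ℕ) (c : ℝ) (φ : ℝ → ℝ) :
    walkSum N (fun x => c * φ x) = c * walkSum N φ := by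
  simp [walkSum, mul_sum]

theorem walkSum_sum {ι : Type*} (s : Finset ι) (N : ℕ) (φ : ι → ℝ → ℝ) :
    walkSum N (fun x => ∑ i ∈ s, φ i x) = ∑ i ∈ s, walkSum N (φ i) := by
  simp only [walkSum]
  rw [sum_comm]

/-- Discrete integration by parts for the simple random walk. -/
theorem walkSum_id_mul (N : ℕ) : ∀ φ : ℝ → ℝ,
    walkSum (N + 1) (fun x => x * φ x) =
      (N + 1) * walkSum N (fun x => φ (x + 1) - φ (x - 1)) := by
  induction N with
  | zero => intro φ; simp [walkSum_succ, walkSum_zero]; ring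
  | succ N ih =>
    intro φ
    rw [walkSum_succ (N + 1)]
    simp_rw [add_mul, sub_mul, one_mul]
    rw [walkSum_add, walkSum_sub, ih (fun x => φ (x + 1)), ih (fun x => φ (x - 1)),
      walkSum_sub (N + 1), walkSum_succ N (fun x => φ (x + 1)), walkSum_succ N (fun x => φ (x - 1))]
    simp only [walkSum_sub, sub_add_cancel, add_sub_cancel_right]
    push_cast
    ring

theorem walkSum_card {V : Type*} [Fintype V] [DecidableEq V] (φ : ℝ → ℝ) :
    ∑ g : V → ZMod 2, φ (∑ x, sgn (g x)) = walkSum (Fintype.card V) φ := by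
  unfold walkSum
  let e := Fintype.equivFin V
  rw [← (e.arrowCongr (Equiv.refl (ZMod 2))).sum_comp]
  refine sum_congr rfl fun g _ => ?_
  congr 1
  rw [← e.sum_comp]
  simp [Equiv.arrowCongr]

theorem sum_range_two_mul (f : ℕ → ℝ) (k : ℕ) :
    ∑ i ∈ range (2 * k), f i = ∑ i ∈ range k, (f (2 * i) + f (2 * i + 1)) := by
  induction k with
  | zero => simp
  | succ k ih => rw [mul_add, mul_one, sum_range_succ, sum_range_succ, ih, sum_range_succ]; ring

theorem add_one_pow_sub_sub_one_pow (k : ℕ) (x : ℝ) :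
    (x + 1) ^ (2 * k + 1) - (x - 1) ^ (2 * k + 1) =
      ∑ i ∈ range (k + 1), 2 * ((2 * k + 1).choose (2 * i) : ℝ) * x ^ (2 * i) := by
  rw [sub_eq_add_neg x, add_pow, add_pow, ← sum_sub_distrib,
    show 2 * k + 1 + 1 = 2 * (k + 1) by ring, sum_range_two_mul]
  refine sum_congr rfl fun i hi => ?_
  have hi' : i ≤ k := by simpa [Nat.lt_succ_iff] using hi
  have h1 : 2 * k + 1 - 2 * i = 2 * (k - i) + 1 := by omega
  have h2 : 2 * k + 1 - (2 * i + 1) = 2 * (k - i) := by omega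
  rw [h1, h2]
  simp only [one_pow, pow_succ, pow_mul]
  norm_num
  ring

theorem walkSum_pow_succ (N k : ℕ) :
    walkSum (N + 1) (fun x => x ^ (2 * (k + 1))) =
      (N + 1) * ∑ i ∈ range (k + 1),
        2 * ((2 * k + 1).choose (2 * i) : ℝ) * walkSum N (fun x => x ^ (2 * i)) := by
  have := walkSum_id_mul N (fun x => x ^ (2 * k + 1))
  simp_rw [add_one_pow_sub_sub_one_pow, walkSum_sum, walkSum_mul, ← pow_succ'] at this
  exact this

/-- The `2k`-th moment `(2k-1)!!` of a standard Gaussian. -/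
def gaussMoment (k : ℕ) : ℝ := ∏ i ∈ range k, (2 * i + 1 : ℝ)

/-- The even moments of the normalized simple random walk converge to the Gaussian ones. -/
theorem tendsto_walk_moment (k : ℕ) :
    Tendsto (fun N : ℕ => walkSum N (fun x => x ^ (2 * k)) / 2 ^ N / (N : ℝ) ^ k) atTop
      (𝓝 (gaussMoment k)) := by
  induction k using Nat.strong_induction_on with
  | _ k ih =>
  cases k with
  | zero => simp [walkSum, gaussMoment]
  | succ k =>
    rw [← tendsto_add_atTop_iff_nat 1]
    have hr : Tendsto (fun N : ℕ => (N : ℝ) / (N + 1)) atTop (𝓝 1) :=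
      tendsto_natCast_div_add_atTop 1
    have hz : Tendsto (fun N : ℕ => 1 / ((N : ℝ) + 1)) atTop (𝓝 0) :=
      tendsto_one_div_add_atTop_nhds_zero_nat
    have hterm : ∀ i ∈ range (k + 1), Tendsto (fun N : ℕ => ((2 * k + 1).choose (2 * i) : ℝ) *
        (walkSum N (fun x => x ^ (2 * i)) / 2 ^ N / (N : ℝ) ^ i *
          (((N : ℝ) / (N + 1)) ^ i * (1 / ((N : ℝ) + 1)) ^ (k - i)))) atTop
        (𝓝 (((2 * k + 1).choose (2 * i) : ℝ) * (gaussMoment i * (1 ^ i * 0 ^ (k - i))))) := by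
      intro i hi
      exact ((ih i (by simpa using hi)).mul ((hr.pow i).mul (hz.pow _))).const_mul _
    have hlim := tendsto_finsetSum _ hterm
    have hval : ∑ i ∈ range (k + 1), ((2 * k + 1).choose (2 * i) : ℝ) *
        (gaussMoment i * (1 ^ i * 0 ^ (k - i))) = gaussMoment (k + 1) := by
      rw [sum_range_succ, sum_eq_zero]
      · simp [gaussMoment, prod_range_succ, Nat.choose_succ_self_right]
        ring
      · intro i hi
        have : k - i ≠ 0 := by have := mem_range.1 hi; omega
        simp [this]
    rw [hval] at hlim
    refine hlim.congr' ?_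
    filter_upwards [eventually_gt_atTop 0] with N hN
    have hN' : (N : ℝ) ≠ 0 := by positivity
    have hN1 : (N : ℝ) + 1 ≠ 0 := by positivity
    rw [walkSum_pow_succ, mul_sum, sum_div, sum_div]
    refine sum_congr rfl fun i hi => ?_
    obtain ⟨d, rfl⟩ := Nat.exists_eq_add_of_le (Nat.lt_succ_iff.1 (mem_range.1 hi))
    push_cast
    rw [Nat.add_sub_cancel_left, div_pow, div_pow]
    field_simp
    ring

/-- A subspace `W` of `𝔽₂^m` on which all triple products sum to zero has at most half the full
dimension; in case of equality, it is closed under products. -/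
theorem triorthogonal_finrank {k : ℕ} (W : Submodule (ZMod 2) (Fin (2 * k) → ZMod 2))
    (hW : ∀ u ∈ W, ∀ v ∈ W, ∀ w ∈ W, ∑ j, u j * v j * w j = 0) :
    Module.finrank (ZMod 2) W < k ∨ ∀ u ∈ W, ∀ v ∈ W, u * v ∈ W := by
  have hidem : ∀ a : ZMod 2, a * a = a := by decide
  let B : LinearMap.BilinForm (ZMod 2) (Fin (2 * k) → ZMod 2) :=
    dotProductBilin (ZMod 2) (ZMod 2)
  have hB : B.Nondegenerate := by
    constructor
    · exact fun x hx => dotProduct_eq_zero x hx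
    · intro x hx
      refine dotProduct_eq_zero x fun w => ?_
      rw [dotProduct_comm]
      exact hx w
  have hle : W ≤ B.orthogonal W := by
    intro u hu
    rw [LinearMap.BilinForm.mem_orthogonal_iff]
    intro v hv
    change v ⬝ᵥ u = 0
    rw [← hW v hv u hu u hu]
    exact sum_congr rfl fun j _ => by rw [mul_assoc, hidem]
  have hdim := LinearMap.BilinForm.finrank_orthogonal hB W
  have hmono := Submodule.finrank_mono hle
  rw [Module.finrank_fin_fun] at hdim
  rcases lt_or_ge (Module.finrank (ZMod 2) W) k with h | h
  · exact Or.inl h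
  · right
    have heq : W = B.orthogonal W := Submodule.eq_of_le_of_finrank_eq hle (by omega)
    intro u hu v hv
    rw [heq, LinearMap.BilinForm.mem_orthogonal_iff]
    intro w hw
    change w ⬝ᵥ (u * v) = 0
    rw [← hW w hw u hu v hv]
    exact sum_congr rfl fun j _ => by rw [Pi.mul_apply, mul_assoc]

/-- The tuple `p` annihilates all monomials of degree between `1` and `3`. -/
def CubicNull {n m : ℕ} (p : Fin m → Fin n → ZMod 2) : Prop :=
  ∀ S : MonIdx n, ∑ j, ∏ i ∈ S.1, p j i = 0

/-- Every point occurs an even number of times in the tuple `p`. -/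
def EvenTuple {n m : ℕ} (p : Fin m → Fin n → ZMod 2) : Prop :=
  ∀ x : Fin n → ZMod 2, ∑ j, (if x = p j then (1 : ZMod 2) else 0) = 0

theorem EvenTuple.cubicNull {n m : ℕ} {p : Fin m → Fin n → ZMod 2} (h : EvenTuple p) :
    CubicNull p := by
  intro S
  calc ∑ j, ∏ i ∈ S.1, p j i
      = ∑ j, ∑ x : Fin n → ZMod 2, (if x = p j then (1 : ZMod 2) else 0) * ∏ i ∈ S.1, x i := by
        simp
    _ = 0 := by
        rw [sum_comm]
        refine sum_eq_zero fun x _ => ?_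
        rw [← sum_mul, h x, zero_mul]

theorem evenTuple_of_monomials {n m : ℕ} {p : Fin m → Fin n → ZMod 2}
    (h : ∀ S : Finset (Fin n), ∑ j, ∏ i ∈ S, p j i = 0) : EvenTuple p := by
  intro x
  have hind : ∀ y : Fin n → ZMod 2,
      (if x = y then (1 : ZMod 2) else 0) = ∏ i, (y i + (x i + 1)) := by
    intro y
    have h1 : ∀ a b : ZMod 2, a + (b + 1) = if b = a then 1 else 0 := by decide
    simp_rw [h1]
    rw [Fintype.prod_ite_zero]
    simp [funext_iff]
  simp_rw [hind, prod_add]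
  rw [sum_comm]
  refine sum_eq_zero fun t _ => ?_
  rw [← sum_mul, h t, zero_mul]

theorem CubicNull.triple {n m : ℕ} {p : Fin m → Fin n → ZMod 2} (h : CubicNull p)
    (a b c : Fin n) : ∑ j, p j a * p j b * p j c = 0 := by
  have hidem : ∀ a : ZMod 2, a * a = a := by decide
  have hidem' : ∀ a b : ZMod 2, a * (b * a) = b * a := by decide
  rw [← h ⟨{a, b, c}, by simp, card_le_three⟩]
  refine sum_congr rfl fun j _ => ?_
  by_cases hab : a = b <;> by_cases hbc : b = c <;> by_cases hac : a = c <;>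
    simp_all [mul_assoc]

theorem CubicNull.span_triple {n m : ℕ} {p : Fin m → Fin n → ZMod 2} (h : CubicNull p) :
    ∀ u ∈ Submodule.span (ZMod 2) (Set.range fun i j => p j i),
    ∀ v ∈ Submodule.span (ZMod 2) (Set.range fun i j => p j i),
    ∀ w ∈ Submodule.span (ZMod 2) (Set.range fun i j => p j i), ∑ j, u j * v j * w j = 0 := by
  intro u hu v hv w hw
  induction hu using Submodule.span_induction with
  | zero => simp
  | add x y _ _ hx hy => simp [add_mul, sum_add_distrib, hx, hy]
  | smul a x _ hx => simp [mul_assoc, ← mul_sum] at hx ⊢; simp [hx]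
  | mem u hu =>
    obtain ⟨a, rfl⟩ := hu
    induction hv using Submodule.span_induction with
    | zero => simp
    | add x y _ _ hx hy => simp [add_mul, mul_add, sum_add_distrib, hx, hy]
    | smul c x _ hx =>
      simp only [Pi.smul_apply, smul_eq_mul, mul_left_comm _ c, mul_assoc, ← mul_sum] at hx ⊢
      rw [hx, mul_zero]
    | mem v hv =>
      obtain ⟨b, rfl⟩ := hv
      induction hw using Submodule.span_induction with
      | zero => simp
      | add x y _ _ hx hy => simp [mul_add, sum_add_distrib, hx, hy]
      | smul d x _ hx =>
        simp only [Pi.smul_apply, smul_eq_mul, mul_left_comm _ d, ← mul_sum] at hx ⊢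
        rw [hx, mul_zero]
      | mem w hw =>
        obtain ⟨c, rfl⟩ := hw
        exact h.triple a b c

/-- A tuple annihilating all cubic monomials is either even or has small rank. -/
theorem CubicNull.evenTuple_or_finrank_lt {n k : ℕ} {p : Fin (2 * k) → Fin n → ZMod 2}
    (h : CubicNull p) : EvenTuple p ∨
      Module.finrank (ZMod 2) (Submodule.span (ZMod 2) (Set.range fun i j => p j i)) < k := by
  rcases triorthogonal_finrank _ h.span_triple with hlt | hmul
  · exact Or.inr hlt
  · left
    refine evenTuple_of_monomials fun S => ?_
    rcases S.eq_empty_or_nonempty with rfl | hS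
    · have : (2 : ZMod 2) = 0 := by decide
      simp [this]
    · set W := Submodule.span (ZMod 2) (Set.range fun i j => p j i) with hWdef
      have hmem : (fun j => ∏ i ∈ S, p j i) ∈ W := by
        induction hS using Finset.Nonempty.cons_induction with
        | singleton a =>
          simp_rw [prod_singleton]
          exact Submodule.subset_span ⟨a, rfl⟩
        | cons a s ha hs ih =>
          simp_rw [prod_cons]
          exact hmul _ (Submodule.subset_span ⟨a, rfl⟩) _ ih
      have hidem : ∀ a : ZMod 2, a * a * a = a := by decide
      have := h.span_triple _ hmem _ hmem _ hmem
      simpa [hidem] using this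

open Classical in
/-- All but few of the tuples annihilating the cubic monomials are even. -/
theorem card_cubicNull_le (n k : ℕ) :
    (univ.filter fun p : Fin (2 * k) → Fin n → ZMod 2 => CubicNull p).card * 2 ^ n ≤
      (univ.filter fun p : Fin (2 * k) → Fin n → ZMod 2 => EvenTuple p).card * 2 ^ n +
        Nat.card (Submodule (ZMod 2) (Fin (2 * k) → ZMod 2)) * (2 ^ n) ^ k := by
  have : Fintype (Submodule (ZMod 2) (Fin (2 * k) → ZMod 2)) := Fintype.ofFinite _
  let T : Submodule (ZMod 2) (Fin (2 * k) → ZMod 2) →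
      Finset (Fin (2 * k) → Fin n → ZMod 2) :=
    fun W => univ.filter fun p => Module.finrank (ZMod 2) W < k ∧ ∀ i, (fun j => p j i) ∈ W
  have hT : ∀ W, (T W).card * 2 ^ n ≤ (2 ^ n) ^ k := by
    intro W
    by_cases hW : Module.finrank (ZMod 2) W < k
    · have hcard : (T W).card ≤ Fintype.card (Fin n → W) := by
        rw [← card_univ]
        refine card_le_card_of_injOn
          (fun p i => if hp : (fun j => p j i) ∈ W then (⟨fun j => p j i, hp⟩ : W) else 0)
          (fun _ _ => mem_coe.2 (mem_univ _)) ?_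
        intro p hp q hq hpq
        have hp' := (mem_filter.1 (mem_coe.1 hp)).2.2
        have hq' := (mem_filter.1 (mem_coe.1 hq)).2.2
        funext j i
        have := congrFun hpq i
        simp only [hp' i, hq' i, dif_pos] at this
        exact congrFun (Subtype.ext_iff.1 this) j
      have hcW : Fintype.card W = 2 ^ Module.finrank (ZMod 2) W := by
        rw [Module.card_eq_pow_finrank (K := ZMod 2), ZMod.card]
      rw [Fintype.card_fun, Fintype.card_fin, hcW] at hcard
      calc (T W).card * 2 ^ n ≤ (2 ^ Module.finrank (ZMod 2) W) ^ n * 2 ^ n :=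
            Nat.mul_le_mul_right _ hcard
        _ = (2 ^ n) ^ (Module.finrank (ZMod 2) W + 1) := by
            rw [pow_succ, ← pow_mul, ← pow_mul, mul_comm n]
        _ ≤ (2 ^ n) ^ k := Nat.pow_le_pow_right (by positivity) hW
    · have : T W = ∅ := filter_eq_empty_iff.2 fun p _ hp => hW hp.1
      simp [this]
  have hsub : (univ.filter fun p : Fin (2 * k) → Fin n → ZMod 2 => CubicNull p) ⊆
      (univ.filter fun p : Fin (2 * k) → Fin n → ZMod 2 => EvenTuple p) ∪ univ.biUnion T := by
    intro p hp
    rcases (mem_filter.1 hp).2.evenTuple_or_finrank_lt with h | h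
    · exact mem_union_left _ (mem_filter.2 ⟨mem_univ _, h⟩)
    · refine mem_union_right _ (mem_biUnion.2 ⟨_, mem_univ _, mem_filter.2 ⟨mem_univ _, h, ?_⟩⟩)
      exact fun i => Submodule.subset_span ⟨i, rfl⟩
  calc _ ≤ ((univ.filter fun p : Fin (2 * k) → Fin n → ZMod 2 => EvenTuple p).card +
          ∑ W, (T W).card) * 2 ^ n :=
        Nat.mul_le_mul_right _ ((card_le_card hsub).trans
          ((card_union_le _ _).trans (Nat.add_le_add_left card_biUnion_le _)))
    _ ≤ _ := by
        rw [add_mul, sum_mul]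
        refine Nat.add_le_add_left ((sum_le_sum fun W _ => hT W).trans ?_) _
        simp [Nat.card_eq_fintype_card]

theorem gap_cast {σ : Type*} [Fintype σ] (f : σ → ZMod 2) : (gap f : ℝ) = ∑ x, sgn (f x) := by
  simp [gap, sgn]

open Classical in
theorem sum_gap_polyFun_pow (n m : ℕ) :
    ∑ α : Coeffs n, (gap (polyFun α) : ℝ) ^ m = Fintype.card (Coeffs n) *
      (univ.filter fun p : Fin m → Fin n → ZMod 2 => CubicNull p).card := by
  simp_rw [gap_cast, polyFun]
  rw [sum_pow_eq_card (fun (S : MonIdx n) (z : Fin n → ZMod 2) => ∏ i ∈ S.1, z i) m]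
  simp only [Fintype.card_fun, ZMod.card, CubicNull]
  push_cast
  congr! 3
  ext p
  simp

open Classical in
theorem walkSum_pow_eq_card (n m : ℕ) :
    walkSum (2 ^ n) (fun x => x ^ m) = 2 ^ 2 ^ n *
      (univ.filter fun p : Fin m → Fin n → ZMod 2 => EvenTuple p).card := by
  have h := sum_pow_eq_card
    (fun (x y : Fin n → ZMod 2) => if x = y then (1 : ZMod 2) else 0) m
  simp only [mul_ite, mul_one, mul_zero, sum_ite_eq', mem_univ, if_true] at h
  rw [walkSum_card (fun x => x ^ m), Fintype.card_fun, ZMod.card, Fintype.card_fin] at h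
  rw [h]
  simp only [EvenTuple]
  congr! 3
  ext p
  simp

/-- All moments of the normalized squared gap of a random cubic polynomial converge to those of
the square of a standard Gaussian. -/
theorem tendsto_gap_moment (k : ℕ) :
    Tendsto (fun n : ℕ => (∑ α : Coeffs n, ((gap (polyFun α) : ℝ) ^ 2 / 2 ^ n) ^ k) /
      (Fintype.card (Coeffs n) : ℝ)) atTop (𝓝 (gaussMoment k)) := by
  classical
  have hpow : Tendsto (fun n : ℕ => 2 ^ n) atTop atTop :=
    tendsto_pow_atTop_atTop_of_one_lt (by norm_num)
  have hlow := (tendsto_walk_moment k).comp hpow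
  set C : ℝ := (Nat.card (Submodule (ZMod 2) (Fin (2 * k) → ZMod 2)) : ℝ)
  have hhigh := hlow.add
    ((tendsto_pow_atTop_nhds_zero_of_lt_one (r := (1 / 2 : ℝ)) (by norm_num)
      (by norm_num)).const_mul C)
  rw [mul_zero, add_zero] at hhigh
  have hcard : ∀ n, (∑ α : Coeffs n, ((gap (polyFun α) : ℝ) ^ 2 / 2 ^ n) ^ k) /
      (Fintype.card (Coeffs n) : ℝ) =
      (univ.filter fun p : Fin (2 * k) → Fin n → ZMod 2 => CubicNull p).card / (2 ^ n) ^ k := by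
    intro n
    have : (Fintype.card (Coeffs n) : ℝ) ≠ 0 := by positivity
    simp_rw [div_pow, ← pow_mul]
    rw [← sum_div, sum_gap_polyFun_pow]
    field_simp
  have hwalk : ∀ n : ℕ, walkSum (2 ^ n) (fun x => x ^ (2 * k)) / 2 ^ 2 ^ n /
      ((2 ^ n : ℕ) : ℝ) ^ k =
      (univ.filter fun p : Fin (2 * k) → Fin n → ZMod 2 => EvenTuple p).card / (2 ^ n) ^ k := by
    intro n
    rw [walkSum_pow_eq_card]
    push_cast
    field_simp
  refine tendsto_of_tendsto_of_tendsto_of_le_of_le hlow hhigh (fun n => ?_) fun n => ?_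
  · simp only [Function.comp_apply]
    rw [hcard, hwalk]
    gcongr with p
    exact EvenTuple.cubicNull
  · simp only [Function.comp_apply]
    rw [hcard, hwalk]
    have h : ((univ.filter fun p : Fin (2 * k) → Fin n → ZMod 2 => CubicNull p).card : ℝ) * 2 ^ n ≤
        (univ.filter fun p : Fin (2 * k) → Fin n → ZMod 2 => EvenTuple p).card * 2 ^ n +
          C * (2 ^ n) ^ k := by
      simp only [C]
      exact_mod_cast card_cubicNull_le n k
    rw [one_div, inv_pow, div_add' _ _ _ (by positivity), div_le_div_iff_of_pos_right (by positivity)]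
    have h2 : (0 : ℝ) < 2 ^ n := by positivity
    rw [← mul_le_mul_iff_of_pos_right h2]
    refine h.trans_eq ?_
    field_simp

/-- A polynomial minorant of the indicator of `P` whose Gaussian expectation exceeds `1 / 12` shows
that `P` eventually has probability at least `1 / 12`. -/
theorem eventually_card_le {d : ℕ} (c : Fin d → ℝ) (P : ℝ → Prop) [DecidablePred P]
    (hP : ∀ t, 0 ≤ t → P t → ∑ i, c i * t ^ (i : ℕ) ≤ 1)
    (hnP : ∀ t, 0 ≤ t → ¬ P t → ∑ i, c i * t ^ (i : ℕ) ≤ 0)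
    (hc : 1 / 12 < ∑ i, c i * gaussMoment i) :
    ∀ᶠ n : ℕ in atTop, Fintype.card (Coeffs n) ≤
      12 * (univ.filter fun α : Coeffs n => P ((gap (polyFun α) : ℝ) ^ 2 / 2 ^ n)).card := by
  have hlim := tendsto_finsetSum univ fun i _ => (tendsto_gap_moment (i : Fin d)).const_mul (c i)
  filter_upwards [hlim.eventually (lt_mem_nhds hc)] with n hn
  have hpos : (0 : ℝ) < Fintype.card (Coeffs n) := by positivity
  simp_rw [← mul_div_assoc, mul_sum] at hn
  rw [← sum_div, sum_comm, lt_div_iff₀ hpos] at hn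
  have hle : ∑ α : Coeffs n, ∑ i, c i * ((gap (polyFun α) : ℝ) ^ 2 / 2 ^ n) ^ (i : ℕ) ≤
      ∑ α : Coeffs n, if P ((gap (polyFun α) : ℝ) ^ 2 / 2 ^ n) then (1 : ℝ) else 0 := by
    refine sum_le_sum fun α _ => ?_
    split_ifs with h
    · exact hP _ (by positivity) h
    · exact hnP _ (by positivity) h
  rw [sum_boole] at hle
  have : (Fintype.card (Coeffs n) : ℝ) ≤
      12 * (univ.filter fun α : Coeffs n => P ((gap (polyFun α) : ℝ) ^ 2 / 2 ^ n)).card := by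
    linarith
  exact_mod_cast this

theorem eventually_card_le_yes :
    ∀ᶠ n : ℕ in atTop, Fintype.card (Coeffs n) ≤
      12 * (univ.filter fun α : Coeffs n => 1 / 2 ≤ (gap (polyFun α) : ℝ) ^ 2 / 2 ^ n).card := by
  have hq : ∀ t : ℝ, ∑ i : Fin 3, (![-19 / 81, 40 / 81, -4 / 81] : Fin 3 → ℝ) i * t ^ (i : ℕ) =
      4 / 81 * ((t - 1 / 2) * (19 / 2 - t)) := by
    intro t
    simp [Fin.sum_univ_succ]
    ring
  refine eventually_card_le ![-19 / 81, 40 / 81, -4 / 81] (fun t => 1 / 2 ≤ t) ?_ ?_ ?_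
  · intro t _ _
    rw [hq]
    nlinarith [sq_nonneg (t - 5)]
  · intro t ht0 ht
    rw [hq]
    nlinarith [not_le.1 ht]
  · simp [Fin.sum_univ_succ, gaussMoment, prod_range_succ]
    norm_num

theorem eventually_card_le_no :
    ∀ᶠ n : ℕ in atTop, Fintype.card (Coeffs n) ≤
      12 * (univ.filter fun α : Coeffs n => (gap (polyFun α) : ℝ) ^ 2 / 2 ^ n ≤ 1 / 4).card := by
  have hq : ∀ t : ℝ, ∑ i : Fin 12, (![1, -146 / 25, 10883 / 1250, -14749 / 2500, 108529 / 50000,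
      -29629 / 62500, 1608453 / 25000000, -138057 / 25000000, 74403 / 250000000,
      -6057 / 625000000, 43281 / 250000000000, -81 / 62500000000] : Fin 12 → ℝ) i * t ^ (i : ℕ) =
      (1 - 4 * t) * (1 - 23 / 25 * t + 1 / 4 * t ^ 2 - 27 / 1000 * t ^ 3 + 3 / 2500 * t ^ 4 -
        9 / 500000 * t ^ 5) ^ 2 := by
    intro t
    simp [Fin.sum_univ_succ]
    ring
  refine eventually_card_le ![1, -146 / 25, 10883 / 1250, -14749 / 2500, 108529 / 50000,
      -29629 / 62500, 1608453 / 25000000, -138057 / 25000000, 74403 / 250000000,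
      -6057 / 625000000, 43281 / 250000000000, -81 / 62500000000] (fun t => t ≤ 1 / 4) ?_ ?_ ?_
  · intro t ht0 ht
    rw [hq]
    have h2 : t ^ 2 ≤ t := by nlinarith
    have h3 : t ^ 3 ≤ t := by nlinarith
    have h5 : t ^ 5 ≤ t := by
      have : t ^ 5 = t ^ 3 * t ^ 2 := by ring
      nlinarith [pow_nonneg ht0 3, pow_nonneg ht0 2]
    have h4 : t ^ 4 ≤ t := by
      have : t ^ 4 = t ^ 2 * t ^ 2 := by ring
      nlinarith [pow_nonneg ht0 2]
    have hp : (1 - 23 / 25 * t + 1 / 4 * t ^ 2 - 27 / 1000 * t ^ 3 + 3 / 2500 * t ^ 4 -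
        9 / 500000 * t ^ 5) ^ 2 ≤ 1 := by
      rw [sq_le_one_iff_abs_le_one, abs_le]
      constructor <;> linarith [pow_nonneg ht0 2, pow_nonneg ht0 3, pow_nonneg ht0 4,
        pow_nonneg ht0 5]
    exact mul_le_one₀ (by linarith) (sq_nonneg _) hp
  · intro t _ ht
    rw [hq]
    exact mul_nonpos_of_nonpos_of_nonneg (by linarith [not_le.1 ht]) (sq_nonneg _)
  · simp [Fin.sum_univ_succ, gaussMoment, prod_range_succ]
    norm_num

theorem card_div_le {ι : Type*} [Fintype ι] (p q : ι → Prop) [DecidablePred p] [DecidablePred q]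
    (hpq : ∀ a, p a → ¬ q a) (hq : Fintype.card ι ≤ 12 * (univ.filter q).card) :
    ((univ.filter p).card : ℚ) / (univ.filter fun a => p a ∨ q a).card ≤ 11 / 12 := by
  classical
  have hdisj : Disjoint (univ.filter p) (univ.filter q) :=
    disjoint_filter.2 fun a _ => hpq a
  have hsum := card_union_of_disjoint hdisj
  have hle := card_le_univ (univ.filter p ∪ univ.filter q)
  rw [filter_or, hsum]
  refine div_le_of_le_mul₀ (by positivity) (by norm_num) ?_
  have : (12 * (univ.filter p).card : ℚ) ≤
      11 * ((univ.filter p).card + (univ.filter q).card : ℕ) := by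
    norm_cast
    omega
  linarith

/-- for all sufficiently large `n`, both the fraction of YES instances
(`gap(f)² ≥ 2^{n−1}`) and the fraction of NO instances (`gap(f)² ≤ 2^{n−2}`) within
`𝓕ₙ^prom` are at most `11/12`. -/
theorem stmt12 :
    ∃ n₀ : ℕ, ∀ n : ℕ, n > n₀ →
      ((Finset.univ.filter
          (fun α : Coeffs n => 2 ^ (n - 1) ≤ (gap (polyFun α)) ^ 2)).card : ℚ) /
        ((Finset.univ.filter
          (fun α : Coeffs n =>
            2 ^ (n - 1) ≤ (gap (polyFun α)) ^ 2 ∨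
              (gap (polyFun α)) ^ 2 ≤ 2 ^ (n - 2))).card) ≤ 11 / 12 ∧
      ((Finset.univ.filter
          (fun α : Coeffs n => (gap (polyFun α)) ^ 2 ≤ 2 ^ (n - 2))).card : ℚ) /
        ((Finset.univ.filter
          (fun α : Coeffs n =>
            2 ^ (n - 1) ≤ (gap (polyFun α)) ^ 2 ∨
              (gap (polyFun α)) ^ 2 ≤ 2 ^ (n - 2))).card) ≤ 11 / 12 := by
  have h := (eventually_card_le_yes.and eventually_card_le_no).and (eventually_ge_atTop 2)
  obtain ⟨n₀, hn₀⟩ := eventually_atTop.1 h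
  refine ⟨n₀, fun n hn => ?_⟩
  obtain ⟨⟨hyes, hno⟩, h2⟩ := hn₀ n hn.le
  obtain ⟨d, rfl⟩ := Nat.exists_eq_add_of_le' h2
  have hyes_iff : ∀ g : ℤ, 1 / 2 ≤ (g : ℝ) ^ 2 / 2 ^ (d + 2) ↔ 2 ^ (d + 2 - 1) ≤ g ^ 2 := by
    intro g
    rw [le_div_iff₀ (by positivity), show d + 2 - 1 = d + 1 by omega, ← @Int.cast_le ℝ]
    push_cast
    rw [pow_succ _ (d + 1)]
    constructor <;> intro h <;> linarith
  have hno_iff : ∀ g : ℤ, (g : ℝ) ^ 2 / 2 ^ (d + 2) ≤ 1 / 4 ↔ g ^ 2 ≤ 2 ^ (d + 2 - 2) := by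
    intro g
    rw [div_le_iff₀ (by positivity), Nat.add_sub_cancel, ← @Int.cast_le ℝ]
    push_cast
    rw [pow_add _ d]
    constructor <;> intro h <;> linarith
  simp only [hyes_iff] at hyes
  simp only [hno_iff] at hno
  have hlt : (2 : ℤ) ^ (d + 2 - 2) < 2 ^ (d + 2 - 1) :=
    pow_lt_pow_right₀ (by norm_num) (by omega)
  refine ⟨card_div_le _ _ (fun α h1 h2 => by linarith) hno, ?_⟩
  simp_rw [or_comm (a := _ ≤ (gap _) ^ 2)]
  exact card_div_le _ _ (fun α h1 h2 => by linarith) hyes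
end
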